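/- arXiv:1912.02437 — 2 statements merged into one kernel-verified Lean document; each statement's English description precedes it below -/
import Mathlib

section
/- Let m ≥ 2 and let H_m be the generalized quaternion group of order 2^{m+1} (Mathlib's QuaternionGroup 2^{m-1}). For the trivial H_m-representation on ℤ, the group cohomology of H_m satisfies: H⁰(H_m; ℤ) ≅ ℤ; H^k(H_m; ℤ) ≅ ℤ/2^{m+1} if k > 0 and k ≡ 0 (mod 4); H^k(H_m; ℤ) ≅ ℤ/2 ⊕ ℤ/2 if k ≡ 2 (mod 4); and H^k(H_m; ℤ) = 0 if k is odd, where all isomorphisms are isomorphisms of abelian groups. -/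
open CategoryTheory MonoidAlgebra

namespace Rep
variable {k G : Type} [CommRing k] [Group G]

/-- The augmentation `k[G] → k`. -/
noncomputable abbrev augmentation (k G : Type) [CommRing k] [Group G] :
    MonoidAlgebra k G →ₐ[k] k :=
  MonoidAlgebra.lift k k G 1

/-- Right multiplication by a matrix over `k[G]`, as a morphism of free representations. -/
noncomputable def freeMatrixHom {α β : Type} [Finite β] (M : Matrix α β (MonoidAlgebra k G)) :
    free k G α ⟶ free k G β :=
  freeLift k G _ fun i ↦ Finsupp.equivFunOnFinite.symm (M i)

lemma free_apply_apply {α : Type} (g : G) (v : α →₀ MonoidAlgebra k G) (i : α) :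
    Representation.free k G α g v i = single g 1 * v i := by
  classical
  induction v using Finsupp.induction_linear with
  | zero => simp
  | add f g hf hg => simp [hf, hg, mul_add]
  | single j a =>
    induction a using MonoidAlgebra.induction_linear with
    | zero => simp
    | add f g hf hg => simp_all [Finsupp.single_add, mul_add]
    | single h r =>
      rw [Representation.free_single_single, Finsupp.single_apply, Finsupp.single_apply]
      split_ifs <;> simp [MonoidAlgebra.single_mul_single]

lemma freeMatrixHom_apply {α β : Type} [Fintype α] [Finite β]
    (M : Matrix α β (MonoidAlgebra k G)) (v : α →₀ MonoidAlgebra k G) :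
    ⇑((freeMatrixHom M).hom v : β →₀ MonoidAlgebra k G) = Matrix.vecMul v M := by
  classical
  induction v using Finsupp.induction_linear with
  | zero => simp
  | add f g hf hg => simp [Matrix.add_vecMul, hf, hg, map_add]
  | single i a =>
    induction a using MonoidAlgebra.induction_linear with
    | zero => simp
    | add f g hf hg => simp_all [Matrix.add_vecMul, map_add, Finsupp.single_add]
    | single g r =>
      ext1 j
      rw [freeMatrixHom, Rep.hom_ofHom, Representation.freeLift_single_single, Finsupp.smul_apply,
        Finsupp.single_eq_pi_single, Matrix.single_vecMul]
      simp only [Matrix.row_apply, Pi.smul_apply, smul_eq_mul]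
      rw [free_apply_apply, ← smul_mul_assoc, MonoidAlgebra.smul_single, smul_eq_mul, mul_one]
      rfl

lemma freeLift_trivial_apply {α : Type} [Fintype α] (f : α → k) (v : α →₀ MonoidAlgebra k G) :
    (freeLift k G (trivial k G k) f).hom v = ∑ i, augmentation k G (v i) * f i := by
  classical
  induction v using Finsupp.induction_linear with
  | zero => simp
  | add f g hf hg => rw [map_add, hf, hg]; simp [add_mul, Finset.sum_add_distrib]
  | single i a =>
    induction a using MonoidAlgebra.induction_linear with
    | zero => simp
    | add f g hf hg =>
      rw [Finsupp.single_add, map_add, hf, hg]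
      simp [add_mul, Finset.sum_add_distrib]
    | single g r =>
      rw [Rep.hom_ofHom, Representation.freeLift_single_single]
      simp [Finsupp.single_apply, Finset.sum_ite_eq, apply_ite]

lemma freeMatrixHom_comp {α β γ : Type} [Fintype α] [Fintype β] [Finite γ]
    (M : Matrix α β (MonoidAlgebra k G)) (N : Matrix β γ (MonoidAlgebra k G)) :
    freeMatrixHom M ≫ freeMatrixHom N = freeMatrixHom (M * N) := by
  refine free_ext _ _ _ _ _ fun i ↦ ?_
  apply DFunLike.coe_injective
  change ⇑((freeMatrixHom N).hom ((freeMatrixHom M).hom _)) = ⇑((freeMatrixHom (M * N)).hom _)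
  rw [freeMatrixHom_apply, freeMatrixHom_apply, freeMatrixHom_apply, Matrix.vecMul_vecMul]

lemma freeMatrixHom_comp_freeLift_trivial {α β : Type} [Fintype α] [Fintype β]
    (M : Matrix α β (MonoidAlgebra k G)) (f : β → k) :
    freeMatrixHom M ≫ freeLift k G (trivial k G k) f =
      freeLift k G (trivial k G k) ((M.map (augmentation k G)).mulVec f) := by
  refine free_ext _ _ _ _ _ fun i ↦ ?_
  change (freeLift k G (trivial k G k) f).hom ((freeMatrixHom M).hom _) = _
  rw [freeLift_trivial_apply, freeMatrixHom_apply, Rep.hom_ofHom,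
    Representation.freeLift_single_single]
  classical
  simp [Finsupp.single_eq_pi_single, Matrix.single_vecMul, Matrix.mulVec, dotProduct]

variable (k G) in
/-- The matrices of an augmented complex of finitely generated free `k[G]`-modules resolving
the trivial representation `k`. -/
structure MatrixResolution where
  rank : ℕ → ℕ
  d (n : ℕ) : Matrix (Fin (rank (n + 1))) (Fin (rank n)) (MonoidAlgebra k G)
  ε : Fin (rank 0) → k
  d_mul_d (n : ℕ) : d (n + 1) * d n = 0
  exact_d (n : ℕ) (v : Fin (rank (n + 1)) → MonoidAlgebra k G) (hv : Matrix.vecMul v (d n) = 0) :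
    ∃ w, Matrix.vecMul w (d (n + 1)) = v
  d_mulVec_ε : ((d 0).map (augmentation k G)).mulVec ε = 0
  exact_ε (v : Fin (rank 0) → MonoidAlgebra k G) (hv : ∑ i, augmentation k G (v i) * ε i = 0) :
    ∃ w, Matrix.vecMul w (d 0) = v
  ε_eq_one : ∃ i, ε i = 1

namespace MatrixResolution

variable (P : MatrixResolution k G)

/-- The complex of free representations attached to the matrices. -/
noncomputable def complex : ChainComplex (Rep k G) ℕ :=
  ChainComplex.of (fun n ↦ free k G (Fin (P.rank n))) (fun n ↦ freeMatrixHom (P.d n)) fun n ↦ by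
    rw [freeMatrixHom_comp, P.d_mul_d]
    refine free_ext _ _ _ _ _ fun i ↦ ?_
    apply DFunLike.coe_injective
    rw [freeMatrixHom_apply, Matrix.vecMul_zero]
    rfl

lemma complex_d (n : ℕ) : P.complex.d (n + 1) n = freeMatrixHom (P.d n) := by
  simp [complex, ChainComplex.of]

lemma complex_d_apply (n : ℕ) (v : Fin (P.rank (n + 1)) →₀ MonoidAlgebra k G) :
    (P.complex.d (n + 1) n).hom v =
      Finsupp.equivFunOnFinite.symm (Matrix.vecMul v (P.d n)) := by
  rw [complex_d]
  exact (Equiv.eq_symm_apply _).2 (freeMatrixHom_apply _ _)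

/-- The augmentation of the complex of free representations. -/
noncomputable def π : P.complex ⟶ (ChainComplex.single₀ (Rep k G)).obj (trivial k G k) :=
  (P.complex.toSingle₀Equiv _).symm ⟨freeLift k G (trivial k G k) P.ε, by
    rw [complex_d]
    refine (freeMatrixHom_comp_freeLift_trivial _ _).trans ?_
    rw [P.d_mulVec_ε]
    exact (freeLiftLEquiv k G _ _).symm.map_zero⟩

lemma π_f_zero : P.π.f 0 = freeLift k G (trivial k G k) P.ε :=
  ChainComplex.toSingle₀Equiv_symm_apply_f_zero _ _

lemma π_f_zero_apply (v : Fin (P.rank 0) →₀ MonoidAlgebra k G) :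
    ((P.π.f 0).hom v : k) = ∑ i, augmentation k G (v i) * P.ε i := by
  rw [π_f_zero]
  exact freeLift_trivial_apply _ _

instance : QuasiIso P.π where
  quasiIsoAt m := by
    cases m with
    | zero =>
      rw [ChainComplex.quasiIsoAt₀_iff, ShortComplex.quasiIso_iff_of_zeros' _ rfl rfl rfl]
      constructor
      · apply (forget₂ _ (ModuleCat k)).reflects_exact_of_faithful
        rw [ShortComplex.moduleCat_exact_iff]
        intro (x : Fin (P.rank 0) →₀ MonoidAlgebra k G) hx
        change (P.π.f 0).hom x = 0 at hx
        obtain ⟨w, hw⟩ := P.exact_ε x ((P.π_f_zero_apply x).symm.trans hx)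
        refine ⟨Finsupp.equivFunOnFinite.symm w, (P.complex_d_apply 0 _).trans ?_⟩
        exact (Equiv.symm_apply_eq _).2 hw
      · rw [Rep.epi_iff_surjective]
        intro x
        obtain ⟨i, hi⟩ := P.ε_eq_one
        refine ⟨Finsupp.single i (single 1 x), ?_⟩
        refine (P.π_f_zero_apply _).trans ?_
        classical
        simp [Finsupp.single_apply, apply_ite, hi]
        exact (MonoidAlgebra.lift_single _ _ _).trans (mul_one _)
    | succ m =>
      rw [quasiIsoAt_iff_exactAt' (hL := ChainComplex.exactAt_succ_single_obj ..),
          HomologicalComplex.exactAt_iff' _ (m + 2) (m + 1) m (by simp) (by simp)]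
      apply (forget₂ _ (ModuleCat k)).reflects_exact_of_faithful
      rw [ShortComplex.moduleCat_exact_iff]
      intro (x : Fin (P.rank (m + 1)) →₀ MonoidAlgebra k G) hx
      change (P.complex.d (m + 1) m).hom x = 0 at hx
      obtain ⟨w, hw⟩ := P.exact_d m x
        ((Equiv.symm_apply_eq _).1 ((P.complex_d_apply m x).symm.trans hx))
      refine ⟨Finsupp.equivFunOnFinite.symm w, (P.complex_d_apply (m + 1) _).trans ?_⟩
      exact (Equiv.symm_apply_eq _).2 hw

/-- The projective resolution of the trivial representation attached to the matrices. -/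
noncomputable def projectiveResolution : ProjectiveResolution (trivial k G k) where
  complex := P.complex
  projective _ := inferInstanceAs <| Projective (free k G _)
  π := P.π

/-- The matrices of the coboundary maps of `P` with trivial coefficients. -/
noncomputable def coboundary (n : ℕ) : (Fin (P.rank n) → k) →ₗ[k] (Fin (P.rank (n + 1)) → k) :=
  ((P.d n).map (augmentation k G)).mulVecLin

lemma coboundary_comp (n : ℕ) : P.coboundary (n + 1) ∘ₗ P.coboundary n = 0 := by
  rw [coboundary, coboundary, ← Matrix.mulVecLin_mul,
    ← AlgHom.coe_toRingHom, ← Matrix.map_mul, P.d_mul_d]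
  simp

/-- Cohomology computed by the matrices with trivial coefficients. -/
abbrev cohomology (n : ℕ) : Type :=
  LinearMap.ker (P.coboundary (n + 1)) ⧸
    (LinearMap.range (P.coboundary n)).submoduleOf (LinearMap.ker (P.coboundary (n + 1)))

/-- The short complex whose homology is the cohomology computed by the matrices. -/
noncomputable abbrev cohomologyShortComplex (n : ℕ) : ShortComplex (ModuleCat k) :=
  ShortComplex.mk (ModuleCat.ofHom (P.coboundary n)) (ModuleCat.ofHom (P.coboundary (n + 1)))
    (by rw [← ModuleCat.ofHom_comp, coboundary_comp]; rfl)

lemma freeLiftLEquiv_comm (n : ℕ) :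
    (freeLiftLEquiv k G (Fin (P.rank n)) (trivial k G k)).toModuleIso.hom ≫
        ModuleCat.ofHom (P.coboundary n) =
      (P.complex.linearYonedaObj k (trivial k G k)).d n (n + 1) ≫
        (freeLiftLEquiv k G (Fin (P.rank (n + 1))) (trivial k G k)).toModuleIso.hom := by
  refine ModuleCat.hom_ext (LinearMap.ext fun f ↦ ?_)
  obtain ⟨f, rfl⟩ := (freeLiftLEquiv k G (Fin (P.rank n)) (trivial k G k)).symm.surjective f
  refine (congrArg (P.coboundary n)
    ((freeLiftLEquiv k G (Fin (P.rank n)) (trivial k G k)).apply_symm_apply f)).trans ?_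
  change P.coboundary n f = freeLiftLEquiv k G (Fin (P.rank (n + 1))) (trivial k G k)
    (P.complex.d (n + 1) n ≫ freeLift k G (trivial k G k) f)
  rw [complex_d]
  refine ((LinearEquiv.eq_symm_apply _).1 ?_).symm
  exact freeMatrixHom_comp_freeLift_trivial _ _

/-- The cochains of the complex of free representations with trivial coefficients are given by
the coboundary matrices. -/
noncomputable def scIso (n : ℕ) :
    (P.complex.linearYonedaObj k (trivial k G k)).sc' n (n + 1) (n + 2) ≅
      P.cohomologyShortComplex n :=
  ShortComplex.isoMk (freeLiftLEquiv k G _ _).toModuleIso (freeLiftLEquiv k G _ _).toModuleIso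
    (freeLiftLEquiv k G _ _).toModuleIso (P.freeLiftLEquiv_comm n)
    (P.freeLiftLEquiv_comm (n + 1))

/-- Group cohomology in positive degrees is computed by the coboundary matrices. -/
noncomputable def groupCohomologyEquiv (n : ℕ) :
    groupCohomology (trivial k G k) (n + 1) ≃ₗ[k] P.cohomology n :=
  (groupCohomologyIso _ (n + 1) P.projectiveResolution ≪≫
    HomologicalComplex.homologyIsoSc' _ n (n + 1) (n + 2) (by simp) (by simp) ≪≫
    ShortComplex.homologyMapIso (P.scIso n) ≪≫
    ShortComplex.moduleCatHomologyIso _).toLinearEquiv ≪≫ₗ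
    Submodule.quotEquivOfEq _ _ (by
      ext x
      exact exists_congr fun y ↦ Subtype.ext_iff)

lemma cohomology_subsingleton {n : ℕ} (h : LinearMap.ker (P.coboundary (n + 1)) = ⊥) :
    Subsingleton (P.cohomology n) := by
  have : Subsingleton (LinearMap.ker (P.coboundary (n + 1))) := by
    rw [h]; infer_instance
  exact (Submodule.mkQ_surjective _).subsingleton

/-- A surjection from the cochains whose kernel is the coboundaries computes the cohomology if
all cochains are cocycles. -/
noncomputable def cohomologyEquivOfSurjective {M : Type} [AddCommGroup M] [Module k M] {n : ℕ}
    (h : P.coboundary (n + 1) = 0) (f : (Fin (P.rank (n + 1)) → k) →ₗ[k] M)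
    (hf : Function.Surjective f) (hker : LinearMap.ker f = LinearMap.range (P.coboundary n)) :
    P.cohomology n ≃ₗ[k] M :=
  Submodule.quotEquivOfEq _ _ (by
      ext x
      exact (SetLike.ext_iff.1 hker x.1).symm) ≪≫ₗ
    (f.domRestrict (LinearMap.ker (P.coboundary (n + 1)))).quotKerEquivOfSurjective fun y ↦ by
      obtain ⟨x, rfl⟩ := hf y
      exact ⟨⟨x, by simp [h]⟩, rfl⟩

end MatrixResolution

section GroupRing

lemma mem_of_augmentation_eq_zero {s : Set G} (hs : Subgroup.closure s = ⊤)
    (I : Ideal (MonoidAlgebra k G)) (hI : ∀ g ∈ s, single g 1 - 1 ∈ I)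
    {a : MonoidAlgebra k G} (ha : augmentation k G a = 0) : a ∈ I := by
  have key (g : G) : single g (1 : k) - 1 ∈ I := by
    induction (hs ▸ Subgroup.mem_top g : g ∈ Subgroup.closure s) using
      Subgroup.closure_induction with
    | mem g hg => exact hI g hg
    | one => simp [MonoidAlgebra.one_def]
    | mul g h _ _ hg hh =>
      convert I.add_mem (I.mul_mem_left (single g 1) hh) hg using 1
      simp [mul_sub, single_mul_single]
    | inv g _ hg =>
      convert I.mul_mem_left (-single g⁻¹ 1) hg using 1
      simp [mul_sub, single_mul_single, MonoidAlgebra.one_def, neg_add_eq_sub]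
  suffices h : ∀ b : MonoidAlgebra k G, b - algebraMap k _ (augmentation k G b) ∈ I by
    simpa [ha] using h a
  intro b
  induction b using MonoidAlgebra.induction_linear with
  | zero => simp
  | add f g hf hg => convert I.add_mem hf hg using 1; rw [map_add, map_add]; abel
  | single g r =>
    convert I.mul_mem_left (algebraMap k _ r) (key g) using 1
    simp [mul_sub, single_mul_single, MonoidAlgebra.one_def]

variable [Fintype G]

variable (k G) in
/-- The sum of all group elements. -/
noncomputable def normElement : MonoidAlgebra k G := ∑ g, single g 1

lemma mul_normElement (a : MonoidAlgebra k G) :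
    a * normElement k G = algebraMap k _ (augmentation k G a) * normElement k G := by
  induction a using MonoidAlgebra.induction_linear with
  | zero => simp
  | add f g hf hg => rw [map_add, map_add, add_mul, hf, hg, add_mul]
  | single g r =>
    simp only [normElement, Finset.mul_sum]
    refine Fintype.sum_equiv (Equiv.mulLeft g) _ _ fun h ↦ ?_
    simp [single_mul_single]

lemma augmentation_normElement : augmentation k G (normElement k G) = Fintype.card G := by
  simp [normElement]

lemma eq_smul_normElement {s : Set G} (hs : Subgroup.closure s = ⊤) {a : MonoidAlgebra k G}
    (ha : ∀ g ∈ s, a * (single g 1 - 1) = 0) : ∃ c : k, a = algebraMap k _ c * normElement k G := by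
  have key (g : G) : a * single g 1 = a := by
    induction (hs ▸ Subgroup.mem_top g : g ∈ Subgroup.closure s) using
      Subgroup.closure_induction with
    | mem g hg => simpa [mul_sub, sub_eq_zero] using ha g hg
    | one => simp [← MonoidAlgebra.one_def]
    | mul g h _ _ hg hh =>
      rw [← one_mul (1 : k), ← single_mul_single, ← mul_assoc, hg, hh]
    | inv g _ hg =>
      conv_lhs => rw [← hg, mul_assoc, single_mul_single]
      simp [← MonoidAlgebra.one_def]
  refine ⟨a.coeff 1, ?_⟩
  ext g
  conv_lhs => rw [← key g]
  classical
  simp [normElement, Finset.mul_sum, single_mul_single, Finsupp.single_apply,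
    coeff_mul_single_apply]

end GroupRing

end Rep

namespace QuaternionGroup

open Rep

variable (n : ℕ)

/-- The integral group ring of the cyclic subgroup of rotations. -/
abbrev CyclicRing : Type := MonoidAlgebra ℤ (Multiplicative (ZMod (2 * n)))

namespace CyclicRing

/-- The generator of the cyclic group. -/
noncomputable def T : CyclicRing n := single (Multiplicative.ofAdd 1) 1

/-- The inverse of the generator of the cyclic group. -/
noncomputable def T' : CyclicRing n := single (Multiplicative.ofAdd (-1)) 1

/-- The involution inverting the group elements. -/
noncomputable def bar : CyclicRing n →ₐ[ℤ] CyclicRing n :=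
  mapDomainAlgHom ℤ ℤ (invMonoidHom : Multiplicative (ZMod (2 * n)) →* _)

/-- The element of order two. -/
noncomputable def Z : CyclicRing n := single (Multiplicative.ofAdd (n : ZMod (2 * n))) 1

/-- The sum of the first `n` powers of the generator. -/
noncomputable def S : CyclicRing n := ∑ i ∈ Finset.range n, T n ^ i

lemma T_mul_T' : T n * T' n = 1 := by
  simp [T, T', single_mul_single, MonoidAlgebra.one_def]

lemma T_pow (i : ℕ) : T n ^ i = single (Multiplicative.ofAdd (i : ZMod (2 * n))) 1 := by
  simp [T, single_pow, ← ofAdd_nsmul]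

lemma T_pow_n : T n ^ n = Z n := T_pow n n

lemma Z_mul_Z : Z n * Z n = 1 := by
  have : (n + n : ZMod (2 * n)) = 0 := by rw [← two_mul]; exact_mod_cast ZMod.natCast_self (2 * n)
  simp [Z, single_mul_single, MonoidAlgebra.one_def, ← ofAdd_add, this]

lemma bar_T : bar n (T n) = T' n := by simp [bar, T, T']

lemma S_mul : S n * (T n - 1) = Z n - 1 := by
  rw [S, geom_sum_mul, T_pow_n]

lemma bar_S : bar n (S n) = S n * T n * Z n := by
  have h : bar n (S n) * T n ^ n = S n * T n := by
    rw [S, map_sum, Finset.sum_mul, ← Finset.sum_range_reflect, Finset.sum_mul]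
    refine Finset.sum_congr rfl fun i hi ↦ ?_
    rw [Finset.mem_range] at hi
    rw [map_pow, bar_T]
    calc T' n ^ (n - 1 - i) * T n ^ n
        = (T n * T' n) ^ (n - 1 - i) * T n ^ i * T n := by
          rw [mul_pow, mul_comm (T n ^ _), mul_assoc, mul_assoc, ← mul_assoc (T n ^ _), ← pow_add,
            ← pow_succ]
          congr 2
          omega
      _ = T n ^ i * T n := by rw [T_mul_T', one_pow, one_mul]
  rw [← h, T_pow_n, mul_assoc, Z_mul_Z, mul_one]

lemma closure_one : Subgroup.closure {Multiplicative.ofAdd (1 : ZMod (2 * n))} = ⊤ := by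
  rw [← Subgroup.zpowers_eq_closure, Subgroup.eq_top_iff']
  intro x
  obtain ⟨i, hi⟩ := ZMod.intCast_surjective x.toAdd
  exact ⟨i, by simp [← ofAdd_zsmul, hi]⟩

variable [NeZero n]

lemma normElement_eq : normElement ℤ (Multiplicative (ZMod (2 * n))) = S n * (1 + Z n) := by
  obtain ⟨c, hc⟩ := eq_smul_normElement (closure_one n) (a := S n * (1 + Z n)) (by
    rintro _ rfl
    change S n * (1 + Z n) * (T n - 1) = 0
    linear_combination (1 + Z n) * S_mul n + Z_mul_Z n)
  have h := congrArg (augmentation ℤ _) hc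
  rw [map_mul, map_mul, augmentation_normElement, AlgHom.commutes] at h
  have h2 : (n : ℤ) * 2 = c * (2 * n) := by
    simpa [S, T, Z] using h
  have hn : (n : ℤ) ≠ 0 := by exact_mod_cast NeZero.ne n
  obtain rfl : c = 1 := mul_right_cancel₀ (mul_ne_zero two_ne_zero hn) (by linarith)
  rw [hc]
  simp

lemma exists_eq_mul_of_mul_eq_zero {a : CyclicRing n} (ha : a * (T n - 1) = 0) :
    ∃ c : ℤ, a = c * (S n * (1 + Z n)) := by
  obtain ⟨c, hc⟩ := eq_smul_normElement (closure_one n) (a := a) (by rintro _ rfl; exact ha)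
  exact ⟨c, by rw [hc, normElement_eq]; simp⟩

lemma exists_eq_mul_sub_one {a : CyclicRing n} (ha : a * (S n * (1 + Z n)) = 0) :
    ∃ t, a = t * (T n - 1) := by
  have hN := mul_normElement a
  rw [normElement_eq, ha] at hN
  have h := congrArg (augmentation ℤ _) hN
  rw [← normElement_eq, map_mul, augmentation_normElement, AlgHom.commutes, map_zero] at h
  have h0 : augmentation ℤ _ a = 0 :=
    (mul_eq_zero.1 h.symm).resolve_right (by exact_mod_cast Fintype.card_ne_zero)
  have := mem_of_augmentation_eq_zero (closure_one n) (Ideal.span {T n - 1}) (by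
    rintro _ rfl; exact Ideal.subset_span rfl) h0
  obtain ⟨t, ht⟩ := Ideal.mem_span_singleton'.1 this
  exact ⟨t, ht.symm⟩

end CyclicRing

open CyclicRing

/-- The inclusion of the rotations. -/
@[simps]
def aHom : Multiplicative (ZMod (2 * n)) →* QuaternionGroup n where
  toFun i := a i.toAdd
  map_one' := rfl
  map_mul' i j := by simp

/-- The inclusion of the group ring of the rotations. -/
noncomputable def cyclicHom : CyclicRing n →ₐ[ℤ] MonoidAlgebra ℤ (QuaternionGroup n) :=
  mapDomainAlgHom ℤ ℤ (aHom n)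

lemma xa_zero_mul_cyclicHom (b : CyclicRing n) :
    single (xa 0) 1 * cyclicHom n b = cyclicHom n (bar n b) * single (xa 0) 1 := by
  induction b using MonoidAlgebra.induction_linear with
  | zero => simp
  | add f g hf hg => simp [mul_add, add_mul, hf, hg]
  | single i r => simp [cyclicHom, bar, single_mul_single]

/-- The element `b + c y` of the group ring, where `y = xa 0`. -/
noncomputable def elt (b c : CyclicRing n) : MonoidAlgebra ℤ (QuaternionGroup n) :=
  cyclicHom n b + cyclicHom n c * single (xa 0) 1

variable {n}

lemma elt_mul_elt (b c d e : CyclicRing n) :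
    elt n b c * elt n d e = elt n (b * d + c * bar n e * Z n) (b * e + c * bar n d) := by
  have hy : single (xa 0) 1 * single (xa 0) 1 = cyclicHom n (Z n) := by
    simp [cyclicHom, Z, single_mul_single]
  simp only [elt, map_add, map_mul, add_mul, mul_add]
  rw [← hy]
  have h1 : cyclicHom n c * single (xa 0) 1 * cyclicHom n d =
      cyclicHom n c * cyclicHom n (bar n d) * single (xa 0) 1 := by
    rw [mul_assoc, xa_zero_mul_cyclicHom, mul_assoc]
  have h2 : cyclicHom n c * single (xa 0) 1 * (cyclicHom n e * single (xa 0) 1) =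
      cyclicHom n c * cyclicHom n (bar n e) * (single (xa 0) 1 * single (xa 0) 1) := by
    rw [mul_assoc, ← mul_assoc (single (xa 0) 1), xa_zero_mul_cyclicHom]
    simp only [mul_assoc]
  rw [h1, h2]
  simp only [mul_assoc]
  abel

lemma elt_add_elt (b c d e : CyclicRing n) : elt n b c + elt n d e = elt n (b + d) (c + e) := by
  simp only [elt, map_add, add_mul]; abel

lemma neg_elt (b c : CyclicRing n) : -elt n b c = elt n (-b) (-c) := by
  simp only [elt, map_neg, neg_mul]; abel

lemma elt_sub_elt (b c d e : CyclicRing n) : elt n b c - elt n d e = elt n (b - d) (c - e) := by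
  simp only [elt, map_sub, sub_mul]; abel

lemma elt_one_zero : elt n 1 0 = 1 := by simp [elt]

lemma elt_zero_zero : elt n 0 0 = 0 := by simp [elt]

lemma exists_eq_elt (u : MonoidAlgebra ℤ (QuaternionGroup n)) : ∃ b c, u = elt n b c := by
  induction u using MonoidAlgebra.induction_linear with
  | zero => exact ⟨0, 0, elt_zero_zero.symm⟩
  | add f g hf hg =>
    obtain ⟨b, c, rfl⟩ := hf
    obtain ⟨d, e, rfl⟩ := hg
    exact ⟨_, _, elt_add_elt ..⟩
  | single g r =>
    rcases g with i | i
    · exact ⟨single (.ofAdd i) r, 0, by simp [elt, cyclicHom]⟩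
    · exact ⟨0, single (.ofAdd (-i)) r, by simp [elt, cyclicHom, single_mul_single]⟩

lemma elt_inj {b c d e : CyclicRing n} : elt n b c = elt n d e ↔ b = d ∧ c = e := by
  refine ⟨fun h ↦ ?_, by rintro ⟨rfl, rfl⟩; rfl⟩
  let p : MonoidAlgebra ℤ (QuaternionGroup n) →+ CyclicRing n :=
    liftNC (algebraMap ℤ (CyclicRing n)) fun g ↦ match g with
      | a i => single (.ofAdd i) 1
      | xa _ => 0
  let q : MonoidAlgebra ℤ (QuaternionGroup n) →+ CyclicRing n :=
    liftNC (algebraMap ℤ (CyclicRing n)) fun g ↦ match g with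
      | a _ => 0
      | xa i => single (.ofAdd (-i)) 1
  have h1 (f : CyclicRing n) : p (cyclicHom n f) = f ∧ p (cyclicHom n f * single (xa 0) 1) = 0 ∧
      q (cyclicHom n f) = 0 ∧ q (cyclicHom n f * single (xa 0) 1) = f := by
    induction f using MonoidAlgebra.induction_linear with
    | zero => simp
    | add f g hf hg => simp [add_mul, hf, hg]
    | single i r => simp [p, q, cyclicHom, single_mul_single, ← zsmul_eq_mul]
  have hp := congrArg p h
  have hq := congrArg q h
  simp only [elt, map_add, h1] at hp hq
  simpa using And.intro hp hq

lemma closure_a_xa : Subgroup.closure {a 1, xa 0} = (⊤ : Subgroup (QuaternionGroup n)) := by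
  rw [Subgroup.eq_top_iff']
  have ha (i : ZMod (2 * n)) : a i ∈ Subgroup.closure {a 1, xa (0 : ZMod (2 * n))} := by
    obtain ⟨z, hz⟩ := ZMod.intCast_surjective i
    have : a i = aHom n (Multiplicative.ofAdd 1) ^ z := by
      rw [← map_zpow]; simp [← ofAdd_zsmul, hz]
    rw [this]
    exact zpow_mem (Subgroup.subset_closure (by simp)) z
  rintro (i | i)
  · exact ha i
  · simpa using mul_mem (Subgroup.subset_closure (by simp) : xa 0 ∈ _) (ha i)

lemma augmentation_elt (b c : CyclicRing n) :
    augmentation ℤ _ (elt n b c) = augmentation ℤ _ b + augmentation ℤ _ c := by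
  have h (f : CyclicRing n) : augmentation ℤ _ (cyclicHom n f) = augmentation ℤ _ f := by
    induction f using MonoidAlgebra.induction_linear with
    | zero => simp
    | add f g hf hg => rw [map_add, map_add, hf, hg, map_add]
    | single i r => simp [cyclicHom]
  simp [elt, h]

lemma elt_T : elt n (T n) 0 = single (a 1) 1 := by simp [elt, T, cyclicHom]

lemma elt_zero_one : elt n 0 1 = single (xa 0) 1 := by simp [elt]

lemma elt_T_sub_one : elt n (T n - 1) 0 = single (a 1) 1 - 1 := by
  rw [← elt_T, ← elt_one_zero, elt_sub_elt, sub_zero]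

lemma elt_neg_one_one : elt n (-1) 1 = single (xa 0) 1 - 1 := by
  rw [← elt_zero_one, ← elt_one_zero, elt_sub_elt, sub_zero, zero_sub]

lemma exact_augmentation {u : MonoidAlgebra ℤ (QuaternionGroup n)} (hu : augmentation ℤ _ u = 0) :
    ∃ v w, v * elt n (T n - 1) 0 + w * elt n (-1) 1 = u := by
  rw [elt_T_sub_one, elt_neg_one_one]
  refine Ideal.mem_span_pair.1 (mem_of_augmentation_eq_zero closure_a_xa _ ?_ hu)
  rintro _ (rfl | rfl) <;> exact Ideal.subset_span (by simp)

section

variable [NeZero n]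

lemma normElement_eq_elt :
    normElement ℤ (QuaternionGroup n) = elt n (S n * (1 + Z n)) (S n * (1 + Z n)) := by
  obtain ⟨c, hc⟩ := eq_smul_normElement (closure_a_xa (n := n))
      (a := elt n (S n * (1 + Z n)) (S n * (1 + Z n))) (by
    rintro _ (rfl | rfl)
    · rw [← elt_T_sub_one, elt_mul_elt, ← elt_zero_zero, elt_inj]
      simp only [map_sub, map_one, map_zero, bar_T]
      constructor
      · linear_combination (1 + Z n) * S_mul n + Z_mul_Z n
      · linear_combination -T' n * (1 + Z n) * S_mul n - T' n * Z_mul_Z n +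
          (S n * (1 + Z n)) * T_mul_T' n
    · rw [← elt_neg_one_one, elt_mul_elt, ← elt_zero_zero, elt_inj]
      simp only [map_neg, map_one]
      constructor
      · linear_combination S n * Z_mul_Z n
      · ring)
  have h := congrArg (augmentation ℤ _) hc
  rw [augmentation_elt, ← normElement_eq, map_mul, augmentation_normElement,
    augmentation_normElement, AlgHom.commutes, QuaternionGroup.card] at h
  have h2 : (2 * n + 2 * n : ℤ) = c * (4 * n) := by simpa using h
  have hn : (n : ℤ) ≠ 0 := by exact_mod_cast NeZero.ne n
  obtain rfl : c = 1 := mul_right_cancel₀ (mul_ne_zero four_ne_zero hn) (by linarith)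
  rw [hc]
  simp

lemma exact_zero {u v : MonoidAlgebra ℤ (QuaternionGroup n)}
    (h : u * elt n (T n - 1) 0 + v * elt n (-1) 1 = 0) :
    ∃ w z, w * elt n (S n) 0 + z * elt n 1 (T n) = u ∧
      w * elt n (-1) (-1) + z * elt n (T n - 1) 0 = v := by
  obtain ⟨a, b, rfl⟩ := exists_eq_elt u
  obtain ⟨c, e, rfl⟩ := exists_eq_elt v
  rw [elt_mul_elt, elt_mul_elt, elt_add_elt, ← elt_zero_zero, elt_inj] at h
  simp only [map_sub, map_one, map_zero, map_neg, bar_T] at h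
  obtain ⟨h₁, h₂⟩ := h
  obtain ⟨q, hq⟩ := exists_eq_mul_of_mul_eq_zero n (a := b - a * T n - e * S n * T n) (by
    linear_combination -T n * h₂ - T n * h₁ + b * T_mul_T' n - e * T n * S_mul n)
  refine ⟨elt n (-q - e) q, elt n (a + (q + e) * S n) 0, ?_, ?_⟩ <;>
    simp only [elt_mul_elt, elt_add_elt, elt_inj, map_sub, map_one, map_zero, map_neg, bar_T, bar_S]
  · constructor
    · ring
    · linear_combination -hq + q * ((1 + Z n) * S_mul n + Z_mul_Z n)
  · constructor
    · linear_combination (q + e) * S_mul n + h₁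
    · ring

lemma exact_one {u v : MonoidAlgebra ℤ (QuaternionGroup n)}
    (h : u * elt n (S n) 0 + v * elt n 1 (T n) = 0)
    (h' : u * elt n (-1) (-1) + v * elt n (T n - 1) 0 = 0) :
    ∃ w, w * elt n (T n - 1) 0 = u ∧ w * elt n 1 (-T n) = v := by
  obtain ⟨a, b, rfl⟩ := exists_eq_elt u
  obtain ⟨c, e, rfl⟩ := exists_eq_elt v
  rw [elt_mul_elt, elt_mul_elt, elt_add_elt, ← elt_zero_zero, elt_inj] at h h'
  simp only [map_sub, map_one, map_zero, map_neg, bar_T, bar_S] at h h'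
  obtain ⟨h₁, h₂⟩ := h
  obtain ⟨h₃, h₄⟩ := h'
  have h₅ : (2 : ℤ) • (a * (S n * (1 + Z n))) = 0 := by
    rw [zsmul_eq_mul]
    push_cast
    linear_combination (1 + Z n) * h₁ - e * T' n * Z_mul_Z n -
      (1 + Z n) * (T' n * h₂ - (b * S n * Z n + c) * T_mul_T' n) + b * S n * Z_mul_Z n -
      S n * (1 + Z n) * h₄ - e * T' n * ((1 + Z n) * S_mul n + Z_mul_Z n) +
      e * S n * (1 + Z n) * T_mul_T' n
  obtain ⟨r, rfl⟩ := exists_eq_mul_sub_one n ((smul_eq_zero.1 h₅).resolve_left two_ne_zero)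
  refine ⟨elt n r (e + r * T n), ?_, ?_⟩ <;>
    simp only [elt_mul_elt, elt_inj, map_sub, map_one, map_zero, map_neg, bar_T]
  · constructor
    · ring
    · linear_combination h₄ + r * T_mul_T' n
  · constructor
    · linear_combination -h₁ + r * S_mul n - r * Z n * T_mul_T' n
    · ring

lemma exact_two {u : MonoidAlgebra ℤ (QuaternionGroup n)}
    (h : u * elt n (T n - 1) 0 = 0) (h' : u * elt n 1 (-T n) = 0) :
    ∃ w, w * normElement ℤ _ = u := by
  obtain ⟨c, hc⟩ := eq_smul_normElement (closure_a_xa (n := n)) (a := u) (by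
    rintro _ (rfl | rfl)
    · rw [← elt_T_sub_one, h]
    · have : elt n 1 (-T n) =
          -(elt n (T n - 1) 0 * elt n (-1) 1 + elt n (T n - 1) 0 + elt n (-1) 1) := by
        rw [elt_mul_elt, elt_add_elt, elt_add_elt, neg_elt, elt_inj]
        simp
      rw [this, mul_neg, mul_add, mul_add, ← mul_assoc, h] at h'
      simpa [elt_neg_one_one] using h')
  exact ⟨_, hc.symm⟩

lemma augmentation_eq_zero_of_mul_normElement {u : MonoidAlgebra ℤ (QuaternionGroup n)}
    (h : u * normElement ℤ _ = 0) : augmentation ℤ _ u = 0 := by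
  rw [mul_normElement] at h
  have := congrArg (augmentation ℤ _) h
  rw [map_mul, augmentation_normElement, AlgHom.commutes, map_zero] at this
  exact (mul_eq_zero.1 this).resolve_right (by exact_mod_cast Fintype.card_ne_zero)

end

variable (n)

/-- The differential from degree one to degree zero. -/
noncomputable def matrixZero : Matrix (Fin 2) (Fin 1) (MonoidAlgebra ℤ (QuaternionGroup n)) :=
  !![elt n (T n - 1) 0; elt n (-1) 1]

/-- The differential from degree two to degree one. -/
noncomputable def matrixOne : Matrix (Fin 2) (Fin 2) (MonoidAlgebra ℤ (QuaternionGroup n)) :=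
  !![elt n (S n) 0, elt n (-1) (-1); elt n 1 (T n), elt n (T n - 1) 0]

/-- The differential from degree three to degree two. -/
noncomputable def matrixTwo : Matrix (Fin 1) (Fin 2) (MonoidAlgebra ℤ (QuaternionGroup n)) :=
  !![elt n (T n - 1) 0, elt n 1 (-T n)]

/-- The differential from degree four to degree three. -/
noncomputable def matrixThree [NeZero n] :
    Matrix (Fin 1) (Fin 1) (MonoidAlgebra ℤ (QuaternionGroup n)) :=
  !![normElement ℤ (QuaternionGroup n)]

lemma matrixOne_mul_matrixZero : matrixOne n * matrixZero n = 0 := by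
  ext1 i j
  fin_cases i <;> fin_cases j <;>
    simp [matrixOne, matrixZero, elt_mul_elt, elt_add_elt, ← elt_zero_zero, elt_inj, bar_T,
      Matrix.vecHead, Matrix.vecTail]
  · linear_combination S_mul n
  · linear_combination T_mul_T' n

lemma matrixTwo_mul_matrixOne : matrixTwo n * matrixOne n = 0 := by
  ext1 i j
  fin_cases i
  fin_cases j <;>
    simp [matrixTwo, matrixOne, elt_mul_elt, elt_add_elt, ← elt_zero_zero, elt_inj, bar_T,
      Matrix.vecHead, Matrix.vecTail]
  · linear_combination S_mul n - Z n * T_mul_T' n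
  · linear_combination -T_mul_T' n

lemma exists_vecMul_matrixZero {v : Fin 1 → MonoidAlgebra ℤ (QuaternionGroup n)}
    (hv : augmentation ℤ _ (v 0) = 0) : ∃ w, Matrix.vecMul w (matrixZero n) = v := by
  obtain ⟨w, z, h⟩ := exact_augmentation hv
  refine ⟨![w, z], ?_⟩
  ext1 j
  fin_cases j
  simpa [matrixZero, Matrix.vecMul, dotProduct] using h

variable [NeZero n]

lemma matrixThree_mul_matrixTwo : matrixThree n * matrixTwo n = 0 := by
  ext1 i j
  fin_cases i
  fin_cases j <;>
    simp [matrixThree, matrixTwo, normElement_eq_elt, elt_mul_elt, ← elt_zero_zero, elt_inj, bar_T]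
  · constructor
    · linear_combination (1 + Z n) * S_mul n + Z_mul_Z n
    · linear_combination -T' n * (1 + Z n) * S_mul n - T' n * Z_mul_Z n +
          (S n * (1 + Z n)) * T_mul_T' n
  · constructor
    · linear_combination T' n * ((1 + Z n) * S_mul n + Z_mul_Z n) -
        S n * (1 + Z n) * T_mul_T' n - T' n * S n * Z_mul_Z n
    · linear_combination -(1 + Z n) * S_mul n - Z_mul_Z n

lemma matrixZero_mul_matrixThree : matrixZero n * matrixThree n = 0 := by
  ext1 i j
  fin_cases i <;> fin_cases j
  · simp [matrixZero, matrixThree, mul_normElement, augmentation_elt, T]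
  · simp [matrixZero, matrixThree, mul_normElement, augmentation_elt, Matrix.vecHead]

lemma exists_vecMul_matrixOne {v : Fin 2 → MonoidAlgebra ℤ (QuaternionGroup n)}
    (hv : Matrix.vecMul v (matrixZero n) = 0) : ∃ w, Matrix.vecMul w (matrixOne n) = v := by
  have h := congrFun hv 0
  obtain ⟨w, z, h₁, h₂⟩ := exact_zero (u := v 0) (v := v 1) (by
    simpa [matrixZero, Matrix.vecMul, dotProduct] using h)
  refine ⟨![w, z], ?_⟩
  ext1 j
  fin_cases j <;> simpa [matrixOne, Matrix.vecMul, dotProduct]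

lemma exists_vecMul_matrixTwo {v : Fin 2 → MonoidAlgebra ℤ (QuaternionGroup n)}
    (hv : Matrix.vecMul v (matrixOne n) = 0) : ∃ w, Matrix.vecMul w (matrixTwo n) = v := by
  obtain ⟨w, h₁, h₂⟩ := exact_one (u := v 0) (v := v 1)
    (by simpa [matrixOne, Matrix.vecMul, dotProduct] using congrFun hv 0)
    (by simpa [matrixOne, Matrix.vecMul, dotProduct] using congrFun hv 1)
  refine ⟨![w], ?_⟩
  ext1 j
  fin_cases j <;> simpa [matrixTwo, Matrix.vecMul, dotProduct]

lemma exists_vecMul_matrixThree {v : Fin 1 → MonoidAlgebra ℤ (QuaternionGroup n)}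
    (hv : Matrix.vecMul v (matrixTwo n) = 0) : ∃ w, Matrix.vecMul w (matrixThree n) = v := by
  obtain ⟨w, h⟩ := exact_two (u := v 0)
    (by simpa [matrixTwo, Matrix.vecMul, dotProduct] using congrFun hv 0)
    (by simpa [matrixTwo, Matrix.vecMul, dotProduct] using congrFun hv 1)
  refine ⟨![w], ?_⟩
  ext1 j
  fin_cases j
  simpa [matrixThree, Matrix.vecMul, dotProduct]

lemma exists_vecMul_matrixZero_of_vecMul_matrixThree
    {v : Fin 1 → MonoidAlgebra ℤ (QuaternionGroup n)}
    (hv : Matrix.vecMul v (matrixThree n) = 0) : ∃ w, Matrix.vecMul w (matrixZero n) = v :=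
  exists_vecMul_matrixZero n <| augmentation_eq_zero_of_mul_normElement
    (by simpa [matrixThree, Matrix.vecMul, dotProduct] using congrFun hv 0)

/-- The ranks of the free modules in the four-periodic resolution. -/
def resolutionRank : ℕ → ℕ
  | 0 => 1
  | 1 => 2
  | 2 => 2
  | 3 => 1
  | i + 4 => resolutionRank i

/-- The matrices of the differentials in the four-periodic resolution. -/
noncomputable def resolutionMatrix : (i : ℕ) →
    Matrix (Fin (resolutionRank (i + 1))) (Fin (resolutionRank i))
      (MonoidAlgebra ℤ (QuaternionGroup n))
  | 0 => matrixZero n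
  | 1 => matrixOne n
  | 2 => matrixTwo n
  | 3 => matrixThree n
  | i + 4 => resolutionMatrix i

lemma resolutionMatrix_mul : ∀ i, resolutionMatrix n (i + 1) * resolutionMatrix n i = 0
  | 0 => matrixOne_mul_matrixZero n
  | 1 => matrixTwo_mul_matrixOne n
  | 2 => matrixThree_mul_matrixTwo n
  | 3 => matrixZero_mul_matrixThree n
  | i + 4 => resolutionMatrix_mul i

lemma exists_vecMul_resolutionMatrix : ∀ i (v : Fin (resolutionRank (i + 1)) → _)
    (_ : Matrix.vecMul v (resolutionMatrix n i) = 0),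
      ∃ w, Matrix.vecMul w (resolutionMatrix n (i + 1)) = v
  | 0, _, hv => exists_vecMul_matrixOne n hv
  | 1, _, hv => exists_vecMul_matrixTwo n hv
  | 2, _, hv => exists_vecMul_matrixThree n hv
  | 3, _, hv => exists_vecMul_matrixZero_of_vecMul_matrixThree n hv
  | i + 4, v, hv => exists_vecMul_resolutionMatrix i v hv

/-- The four-periodic resolution of the trivial representation of the quaternion group. -/
noncomputable def resolution : MatrixResolution ℤ (QuaternionGroup n) where
  rank := resolutionRank
  d := resolutionMatrix n
  ε _ := 1
  d_mul_d := resolutionMatrix_mul n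
  exact_d := exists_vecMul_resolutionMatrix n
  d_mulVec_ε := by
    have h : ((matrixZero n).map (augmentation ℤ _)).mulVec (fun _ ↦ 1) = 0 := by
      ext i
      fin_cases i
      · simp [matrixZero, Matrix.mulVec, dotProduct, augmentation_elt, T]
      · simp [matrixZero, Matrix.mulVec, dotProduct, augmentation_elt]
    exact h
  exact_ε (v : Fin 1 → _) hv := exists_vecMul_matrixZero n <| by
    have h : ∑ i : Fin 1, augmentation ℤ _ (v i) * 1 = 0 := hv
    simpa using h
  ε_eq_one := ⟨(0 : Fin 1), rfl⟩

section Cohomology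

lemma resolution_coboundary_zero : (resolution n).coboundary 0 = 0 := by
  have h : (matrixZero n).map (augmentation ℤ _) = 0 := by
    ext1 i j
    fin_cases i <;> fin_cases j
    · simp [matrixZero, augmentation_elt, T]
    · simp [matrixZero, augmentation_elt]
  exact (congrArg Matrix.mulVecLin h).trans Matrix.mulVecLin_zero

lemma resolution_coboundary_one (v : Fin 2 → ℤ) :
    (resolution n).coboundary 1 v = ![n * v 0 - 2 * v 1, 2 * v 0] := by
  change Matrix.mulVec ((matrixOne n).map (augmentation ℤ _)) v = _
  ext i
  fin_cases i
  · simp [matrixOne, Matrix.mulVec, dotProduct, augmentation_elt, S, T]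
    ring
  · simp [matrixOne, Matrix.mulVec, dotProduct, augmentation_elt, T]

lemma resolution_coboundary_two : (resolution n).coboundary 2 = 0 := by
  have h : (matrixTwo n).map (augmentation ℤ _) = 0 := by
    ext1 i j
    fin_cases i
    fin_cases j <;> simp [matrixTwo, augmentation_elt, T]
  exact (congrArg Matrix.mulVecLin h).trans Matrix.mulVecLin_zero

lemma resolution_coboundary_three (v : Fin 1 → ℤ) :
    (resolution n).coboundary 3 v = ![4 * n * v 0] := by
  change Matrix.mulVec ((matrixThree n).map (augmentation ℤ _)) v = _
  ext i
  fin_cases i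
  simp [matrixThree, Matrix.mulVec, dotProduct, augmentation_normElement, QuaternionGroup.card]

lemma resolution_cohomology_zero : Subsingleton ((resolution n).cohomology 0) := by
  refine (resolution n).cohomology_subsingleton <|
    LinearMap.ker_eq_bot'.2 fun (v : Fin 2 → ℤ) hv ↦ ?_
  have h := (resolution_coboundary_one n v).symm.trans hv
  have h₀ : n * v 0 - 2 * v 1 = 0 := congrFun h (0 : Fin 2)
  have h₁ : 2 * v 0 = 0 := congrFun h (1 : Fin 2)
  have h₂ : v 0 = 0 := by omega
  rw [h₂] at h₀
  have h₃ : v 1 = 0 := by omega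
  ext i
  fin_cases i
  exacts [h₂, h₃]

lemma resolution_cohomology_two : Subsingleton ((resolution n).cohomology 2) := by
  refine (resolution n).cohomology_subsingleton <|
    LinearMap.ker_eq_bot'.2 fun (v : Fin 1 → ℤ) hv ↦ ?_
  have h : 4 * n * v 0 = 0 :=
    congrFun ((resolution_coboundary_three n v).symm.trans hv) (0 : Fin 1)
  have h₀ : v 0 = 0 := by simpa [NeZero.ne n] using h
  ext i
  fin_cases i
  exact h₀

/-- The second cohomology group of the resolution if `n` is even. -/
noncomputable def resolutionCohomologyOneEquiv (hn : Even n) :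
    (resolution n).cohomology 1 ≃ₗ[ℤ] ZMod 2 × ZMod 2 :=
  let f : (Fin 2 → ℤ) →ₗ[ℤ] ZMod 2 × ZMod 2 :=
    LinearMap.prod
      ((Int.castAddHom (ZMod 2)).toIntLinearMap ∘ₗ LinearMap.proj 0)
      ((Int.castAddHom (ZMod 2)).toIntLinearMap ∘ₗ LinearMap.proj 1)
  (resolution n).cohomologyEquivOfSurjective (resolution_coboundary_two n) f
    (fun ⟨x, y⟩ ↦ by
      obtain ⟨p, rfl⟩ := ZMod.intCast_surjective x
      obtain ⟨q, rfl⟩ := ZMod.intCast_surjective y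
      exact ⟨![p, q], rfl⟩)
    (by
      obtain ⟨m, hm⟩ := hn
      ext (v : Fin 2 → ℤ)
      have hv : v ∈ LinearMap.ker f ↔ (2 : ℤ) ∣ v 0 ∧ (2 : ℤ) ∣ v 1 := by
        simp [f, ZMod.intCast_zmod_eq_zero_iff_dvd]
      refine hv.trans ⟨?_, ?_⟩
      · rintro ⟨⟨p, hp⟩, q, hq⟩
        refine ⟨![q, m * q - p], (resolution_coboundary_one n _).trans ?_⟩
        ext i
        fin_cases i
        · simp [hp, hm]; ring
        · simp [hq]
      · rintro ⟨(w : Fin 2 → ℤ), hw⟩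
        have hw := (resolution_coboundary_one n w).symm.trans hw
        subst hw hm
        exact ⟨⟨m * w 0 - w 1, by simp; ring⟩, by simp⟩)

/-- The fourth cohomology group of the resolution. -/
noncomputable def resolutionCohomologyThreeEquiv :
    (resolution n).cohomology 3 ≃ₗ[ℤ] ZMod (4 * n) :=
  let f : (Fin 1 → ℤ) →ₗ[ℤ] ZMod (4 * n) :=
    (Int.castAddHom (ZMod (4 * n))).toIntLinearMap ∘ₗ LinearMap.proj 0
  (resolution n).cohomologyEquivOfSurjective (resolution_coboundary_zero n) f
    (fun x ↦ by
      obtain ⟨p, rfl⟩ := ZMod.intCast_surjective x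
      exact ⟨![p], rfl⟩)
    (by
      ext (v : Fin 1 → ℤ)
      have hv : v ∈ LinearMap.ker f ↔ (4 * n : ℤ) ∣ v 0 := by
        simpa [f] using ZMod.intCast_zmod_eq_zero_iff_dvd (v 0) (4 * n)
      refine hv.trans ⟨?_, ?_⟩
      · rintro ⟨p, hp⟩
        refine ⟨![p], (resolution_coboundary_three n _).trans ?_⟩
        ext i
        fin_cases i
        simp [hp]
      · rintro ⟨(w : Fin 1 → ℤ), hw⟩
        have hw := (resolution_coboundary_three n w).symm.trans hw
        subst hw
        simp)

/-- The four-periodicity of the cohomology of the resolution. -/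
noncomputable def resolutionCohomologyPeriodicEquiv (r : ℕ) :
    (q : ℕ) → (resolution n).cohomology (r + 4 * q) ≃ₗ[ℤ] (resolution n).cohomology r
  | 0 => .refl ..
  | q + 1 => resolutionCohomologyPeriodicEquiv r q

/-- The group cohomology of the quaternion group in terms of the resolution. -/
noncomputable def groupCohomologyEquiv (r q : ℕ) :
    groupCohomology (Rep.trivial ℤ (QuaternionGroup n) ℤ) (r + 4 * q + 1) ≃ₗ[ℤ]
      (resolution n).cohomology r :=
  (resolution n).groupCohomologyEquiv _ ≪≫ₗ resolutionCohomologyPeriodicEquiv n r q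

end Cohomology

end QuaternionGroup

/-- **Statement 6.** For `m ≥ 2` and the generalized quaternion group
`H_m = QuaternionGroup (2^(m-1))` of order `2^(m+1)`, the group cohomology with coefficients
in the trivial representation on `ℤ` satisfies `H⁰ ≅ ℤ`; `H^k ≅ ℤ/2^{m+1}` if `k > 0` and
`k ≡ 0 (mod 4)`; `H^k ≅ ℤ/2 ⊕ ℤ/2` if `k ≡ 2 (mod 4)`; and `H^k = 0` if `k` is odd. -/
theorem groupCohomology_quaternionGroup_trivial_int (m : ℕ) (hm : 2 ≤ m) :
    Nonempty
      ((groupCohomology (Rep.trivial ℤ (QuaternionGroup (2 ^ (m - 1))) ℤ) 0) ≃+ ℤ) ∧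
    (∀ k : ℕ,
      (0 < k → k % 4 = 0 →
        Nonempty
          ((groupCohomology (Rep.trivial ℤ (QuaternionGroup (2 ^ (m - 1))) ℤ) k) ≃+
            ZMod (2 ^ (m + 1)))) ∧
      (k % 4 = 2 →
        Nonempty
          ((groupCohomology (Rep.trivial ℤ (QuaternionGroup (2 ^ (m - 1))) ℤ) k) ≃+
            (ZMod 2 × ZMod 2))) ∧
      (k % 2 = 1 →
        Subsingleton
          (groupCohomology (Rep.trivial ℤ (QuaternionGroup (2 ^ (m - 1))) ℤ) k))) := by
  have : NeZero (2 ^ (m - 1)) := ⟨by positivity⟩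
  have hn : 4 * 2 ^ (m - 1) = 2 ^ (m + 1) := by
    rw [show m + 1 = m - 1 + 2 by omega, pow_add]; ring
  have hcard : Even (2 ^ (m - 1)) := (even_two.pow_of_ne_zero (by omega))
  refine ⟨⟨(groupCohomology.H0IsoOfIsTrivial _).toLinearEquiv.toAddEquiv⟩,
    fun k ↦ ⟨fun h₀ h ↦ ?_, fun h ↦ ?_, fun h ↦ ?_⟩⟩
  · obtain ⟨q, rfl⟩ : ∃ q, k = 3 + 4 * q + 1 := ⟨k / 4 - 1, by omega⟩
    rw [← hn]
    exact ⟨(QuaternionGroup.groupCohomologyEquiv _ 3 q ≪≫ₗ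
      QuaternionGroup.resolutionCohomologyThreeEquiv _).toAddEquiv⟩
  · obtain ⟨q, rfl⟩ : ∃ q, k = 1 + 4 * q + 1 := ⟨k / 4, by omega⟩
    exact ⟨(QuaternionGroup.groupCohomologyEquiv _ 1 q ≪≫ₗ
      QuaternionGroup.resolutionCohomologyOneEquiv _ hcard).toAddEquiv⟩
  · obtain h | h : k % 4 = 1 ∨ k % 4 = 3 := by omega
    · obtain ⟨q, rfl⟩ : ∃ q, k = 0 + 4 * q + 1 := ⟨k / 4, by omega⟩
      have := QuaternionGroup.resolution_cohomology_zero (2 ^ (m - 1))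
      exact (QuaternionGroup.groupCohomologyEquiv _ 0 q).injective.subsingleton
    · obtain ⟨q, rfl⟩ : ∃ q, k = 2 + 4 * q + 1 := ⟨k / 4, by omega⟩
      have := QuaternionGroup.resolution_cohomology_two (2 ^ (m - 1))
      exact (QuaternionGroup.groupCohomologyEquiv _ 2 q).injective.subsingleton
end

section
/- Let Q₈ be the quaternion group of order 8 (Mathlib's QuaternionGroup 2). For the trivial representation of Q₈ on ℤ: the multiplication-by-2 endomorphism of the abelian group H²(Q₈; ℤ) is the zero map, and H¹(Q₈; ℤ) = 0 and H³(Q₈; ℤ) = 0. (These are the facts used to show that the mod-2 Bockstein β₂ : H¹(BQ₈; ℤ/2) → H²(BQ₈; ℤ/2) is an isomorphism.) -/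
/-- The quaternion group `Q₈` of order 8. -/
abbrev Q8 : Type := QuaternionGroup 2

namespace QuaternionGroup

variable {n : ℕ} {E : Type*} [Group E]

/-- The homomorphism out of `QuaternionGroup n` determined by the images `α` of `a 1` and `ξ` of
`xa 0`, which have to satisfy the relations of the standard presentation. -/
noncomputable def lift (α ξ : E) (hα : α ^ (2 * n) = 1) (hξ : ξ * ξ = α ^ n)
    (hαξ : ξ * α⁻¹ = α * ξ) : QuaternionGroup n →* E :=
  let φ : ZMod (2 * n) →+ Additive E :=
    ZMod.lift _ ⟨zmultiplesHom _ (Additive.ofMul α), by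
      rw [zmultiplesHom_apply, natCast_zsmul, ← ofMul_pow, hα, ofMul_one]⟩
  have hφ (m : ℤ) : (φ m).toMul = α ^ m := by simp [φ]
  have hswap (i : ZMod (2 * n)) : (φ i).toMul * ξ = ξ * (φ (-i)).toMul := by
    obtain ⟨m, rfl⟩ := ZMod.intCast_surjective i
    have h : SemiconjBy ξ α⁻¹ α := hαξ
    rw [← Int.cast_neg, hφ, hφ, zpow_neg, ← inv_zpow]
    exact (h.zpow_right m).symm
  have hn : (φ n).toMul = α ^ n := by simpa using hφ n
  { toFun
      | a i => (φ i).toMul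
      | xa i => ξ * (φ i).toMul
    map_one' := by
      change (φ 0).toMul = 1
      simp
    map_mul' := by
      rintro (i | i) (j | j)
      · simp
      · simp only [a_mul_xa, ← mul_assoc, hswap]
        rw [mul_assoc, ← toMul_add, ← map_add, neg_add_eq_sub]
      · simp [mul_assoc]
      · simp only [xa_mul_xa]
        rw [mul_assoc ξ, ← mul_assoc _ ξ, hswap, ← mul_assoc, ← mul_assoc, hξ, ← hn, mul_assoc,
          ← toMul_add, ← toMul_add, ← map_add, ← map_add]
        congr 2
        ring }

theorem lift_a_one (α ξ : E) (hα : α ^ (2 * n) = 1) (hξ : ξ * ξ = α ^ n)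
    (hαξ : ξ * α⁻¹ = α * ξ) : lift α ξ hα hξ hαξ (a 1) = α := by
  have : ((1 : ℤ) : ZMod (2 * n)) = 1 := Int.cast_one
  simp only [lift, MonoidHom.coe_mk, OneHom.coe_mk, ← this, ZMod.lift_coe]
  simp

theorem lift_xa_zero (α ξ : E) (hα : α ^ (2 * n) = 1) (hξ : ξ * ξ = α ^ n)
    (hαξ : ξ * α⁻¹ = α * ξ) : lift α ξ hα hξ hαξ (xa 0) = ξ := by
  simp [lift]

theorem monoidHom_ext {f g : QuaternionGroup n →* E} (ha : f (a 1) = g (a 1))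
    (hx : f (xa 0) = g (xa 0)) : f = g := by
  have key (i : ZMod (2 * n)) : f (a i) = g (a i) := by
    obtain ⟨m, rfl⟩ := ZMod.intCast_surjective i
    have hm : (a (m : ZMod (2 * n)) : QuaternionGroup n) = a 1 ^ m := by
      induction m with
      | zero => simp
      | succ k ih =>  rw [zpow_add_one, ← ih, a_mul_a]; push_cast; rfl
      | pred k ih =>
        rw [zpow_sub_one, ← ih, eq_mul_inv_iff_mul_eq, a_mul_a]; push_cast; congr 1; ring
    rw [hm, map_zpow, map_zpow, ha]
  ext (i | i)
  · exact key i
  · rw [← zero_add i, ← xa_mul_a, map_mul, map_mul, hx, key]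

/-- A central extension of a generalised quaternion group splits if every element of its kernel is
a square in the kernel. -/
theorem exists_section_of_central (π : E →* QuaternionGroup n) (hπ : Function.Surjective π)
    (hcentral : ∀ z ∈ π.ker, ∀ e, z * e = e * z) (hsq : ∀ z ∈ π.ker, ∃ w ∈ π.ker, w * w = z) :
    ∃ s : QuaternionGroup n →* E, π.comp s = MonoidHom.id _ := by
  obtain ⟨α₀, hα₀⟩ := hπ (a 1)
  obtain ⟨ξ₀, hξ₀⟩ := hπ (xa 0)
  -- rescale the lift of `a 1` so that conjugation by `ξ₀` inverts it
  obtain ⟨t, ht, htt⟩ := hsq (α₀⁻¹ * ξ₀ * α₀⁻¹ * ξ₀⁻¹) <| by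
    rw [MonoidHom.mem_ker, map_mul, map_mul, map_mul, map_inv, map_inv, hα₀, hξ₀,
      mul_inv_eq_one, mul_inv_eq_iff_eq_mul, inv_mul_eq_iff_eq_mul]
    simp
  have htc : ∀ e, Commute t e := hcentral t ht
  obtain ⟨α, hα, hαξ₀⟩ : ∃ α, π α = a 1 ∧ ξ₀ * α⁻¹ = α * ξ₀ := by
    refine ⟨α₀ * t, by rw [map_mul, hα₀, MonoidHom.mem_ker.1 ht, mul_one], ?_⟩
    have h : ξ₀ * α₀⁻¹ = α₀ * (t * t) * ξ₀ := by rw [htt]; group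
    rw [mul_inv_rev, ← mul_assoc, ← (htc ξ₀).inv_left.eq, mul_assoc, h, inv_mul_eq_iff_eq_mul]
    simp only [← mul_assoc, (htc α₀).eq]
  -- rescale `ξ₀` so that its square is `α ^ n`
  obtain ⟨u, hu, huu⟩ := hsq ((ξ₀ * ξ₀)⁻¹ * α ^ n) <| by
    rw [MonoidHom.mem_ker, map_mul, map_inv, map_mul, map_pow, hα, hξ₀, inv_mul_eq_one]
    simp
  have huc : ∀ e, Commute u e := hcentral u hu
  have hξ : ξ₀ * u * (ξ₀ * u) = α ^ n := by
    rw [(huc ξ₀).mul_mul_mul_comm, huu, mul_inv_cancel_left]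
  have hαξ : ξ₀ * u * α⁻¹ = α * (ξ₀ * u) := by
    rw [mul_assoc, (huc _).eq, ← mul_assoc, hαξ₀, mul_assoc]
  have hα2 : α ^ (2 * n) = 1 := by
    have h : SemiconjBy (ξ₀ * u) α⁻¹ α := hαξ
    have h1 := (h.pow_right n).eq
    rw [← hξ, mul_assoc (ξ₀ * u), mul_right_inj, hξ, inv_pow, inv_eq_iff_mul_eq_one] at h1
    rw [two_mul, pow_add, h1]
  refine ⟨lift α (ξ₀ * u) hα2 hξ hαξ, monoidHom_ext ?_ ?_⟩
  · simp [lift_a_one, hα]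
  · simp [lift_xa_zero, hξ₀, MonoidHom.mem_ker.1 hu]

end QuaternionGroup

/-- The underlying set `D × G` of the central extension of `G` by `D` attached to a `2`-cocycle. -/
structure CocycleExtension {G D : Type*} [Group G] [AddCommGroup D] (b : G → G → D) where
  /-- the component in the kernel -/
  fst : D
  /-- the component in the quotient -/
  snd : G

namespace CocycleExtension

variable {G D : Type*} [Group G] [AddCommGroup D] {b : G → G → D}

@[ext]
theorem ext {x y : CocycleExtension b} (h₁ : x.fst = y.fst) (h₂ : x.snd = y.snd) : x = y := by
  cases x; cases y; simp_all

instance : Mul (CocycleExtension b) := ⟨fun x y => ⟨x.fst + y.fst + b x.snd y.snd, x.snd * y.snd⟩⟩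
instance : One (CocycleExtension b) := ⟨⟨-b 1 1, 1⟩⟩
instance : Inv (CocycleExtension b) := ⟨fun x => ⟨-x.fst - b x.snd⁻¹ x.snd - b 1 1, x.snd⁻¹⟩⟩

@[simp] theorem fst_mul (x y : CocycleExtension b) :
    (x * y).fst = x.fst + y.fst + b x.snd y.snd := rfl
@[simp] theorem snd_mul (x y : CocycleExtension b) : (x * y).snd = x.snd * y.snd := rfl
@[simp] theorem fst_one : (1 : CocycleExtension b).fst = -b 1 1 := rfl
@[simp] theorem snd_one : (1 : CocycleExtension b).snd = 1 := rfl
@[simp] theorem fst_inv (x : CocycleExtension b) :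
    x⁻¹.fst = -x.fst - b x.snd⁻¹ x.snd - b 1 1 := rfl
@[simp] theorem snd_inv (x : CocycleExtension b) : x⁻¹.snd = x.snd⁻¹ := rfl

/-- The multiplication twisted by a `2`-cocycle is a group law. -/
abbrev group (hb : ∀ g h k, b g h + b (g * h) k = b h k + b g (h * k)) :
    Group (CocycleExtension b) :=
  Group.ofLeftAxioms
    (fun x y z => by
      ext
      · simp only [fst_mul, snd_mul]
        rw [← sub_eq_zero, ← sub_eq_zero.2 (hb x.snd y.snd z.snd)]
        abel
      · simp [mul_assoc])
    (fun x => by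
      ext
      · have := hb 1 1 x.snd
        simp only [one_mul, add_left_inj] at this
        simp [this]
      · simp)
    (fun x => by
      ext
      · simp only [fst_mul, fst_inv, snd_inv, fst_one]
        abel
      · simp)

end CocycleExtension

/-- Every `2`-cocycle of a generalised quaternion group with values in a trivial module on which
multiplication by `2` is surjective is a coboundary. -/
theorem QuaternionGroup.exists_eq_coboundary_of_cocycle {n : ℕ} {D : Type*} [AddCommGroup D]
    (hD : ∀ d : D, ∃ e, e + e = d) (b : QuaternionGroup n → QuaternionGroup n → D)
    (hb : ∀ g h k, b g h + b (g * h) k = b h k + b g (h * k)) :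
    ∃ c : QuaternionGroup n → D, ∀ g h, b g h = c h - c (g * h) + c g := by
  let _ := CocycleExtension.group hb
  have hb₁ (g) : b 1 g = b 1 1 := by simpa using (hb 1 1 g).symm
  have hb₂ (g) : b g 1 = b 1 1 := by simpa using hb g 1 1
  let π : CocycleExtension b →* QuaternionGroup n :=
    { toFun := CocycleExtension.snd, map_one' := rfl, map_mul' := fun _ _ => rfl }
  obtain ⟨s, hs⟩ := exists_section_of_central π (fun g => ⟨⟨0, g⟩, rfl⟩)
    (fun z hz e => by
      have hz : z.snd = 1 := hz
      ext
      · simp [hz, hb₁ e.snd, hb₂ e.snd, add_comm]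
      · simp [hz])
    (fun z hz => by
      have hz : z.snd = 1 := hz
      obtain ⟨e, he⟩ := hD (z.fst - b 1 1)
      refine ⟨⟨e, 1⟩, rfl, ?_⟩
      ext
      · simp [he]
      · simp [hz])
  have hsnd (g) : (s g).snd = g := DFunLike.congr_fun hs g
  refine ⟨fun g => -(s g).fst, fun g h => ?_⟩
  have := congrArg CocycleExtension.fst (map_mul s g h)
  simp only [CocycleExtension.fst_mul, hsnd] at this
  simp only [this]
  abel

theorem AddCircle.exists_intCast_eq {x : ℚ} (hx : (x : AddCircle (1 : ℚ)) = 0) :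
    ∃ m : ℤ, (m : ℚ) = x := by
  simpa using AddCircle.coe_eq_zero_iff (1 : ℚ) |>.1 hx

/-- Integral `3`-cocycles of a generalised quaternion group are coboundaries. -/
theorem QuaternionGroup.exists_eq_coboundary_of_cocycle₃ {n : ℕ} [NeZero n]
    (f : QuaternionGroup n → QuaternionGroup n → QuaternionGroup n → ℤ)
    (hf : ∀ g h j k, f h j k - f (g * h) j k + f g (h * j) k - f g h (j * k) + f g h j = 0) :
    ∃ c : QuaternionGroup n → QuaternionGroup n → ℤ,
      ∀ g h j, f g h j = c h j - c (g * h) j + c g (h * j) - c g h := by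
  let N : ℚ := Fintype.card (QuaternionGroup n)
  have hN : N ≠ 0 := Nat.cast_ne_zero.2 Fintype.card_ne_zero
  let b (g h : QuaternionGroup n) : ℚ := -(∑ k, (f g h k : ℚ)) / N
  have hb (g h j) : (f g h j : ℚ) = b h j - b (g * h) j + b g (h * j) - b g h := by
    have hsum : ∑ k, ((f h j k : ℚ) - f (g * h) j k + f g (h * j) k - f g h (j * k) + f g h j)
        = 0 := Finset.sum_eq_zero fun k _ => mod_cast hf g h j k
    simp only [Finset.sum_add_distrib, Finset.sum_sub_distrib, Finset.sum_const,
      Finset.card_univ, nsmul_eq_mul] at hsum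
    rw [(Group.mulLeft_bijective j).sum_comp fun k => (f g h k : ℚ)] at hsum
    simp only [b]
    field_simp
    linear_combination hsum
  obtain ⟨c, hc⟩ := exists_eq_coboundary_of_cocycle (D := AddCircle (1 : ℚ))
    (fun d => by
      obtain ⟨q, rfl⟩ := QuotientAddGroup.mk_surjective d
      exact ⟨((q / 2 : ℚ) : AddCircle (1 : ℚ)), by rw [← AddCircle.coe_add, add_halves]⟩)
    (fun g h => (b g h : AddCircle (1 : ℚ)))
    (fun g h j => by
      have h0 : ((f g h j : ℚ) : AddCircle (1 : ℚ)) = 0 :=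
        (AddCircle.coe_eq_zero_iff _).2 ⟨f g h j, by simp⟩
      rw [hb] at h0
      simp only [AddCircle.coe_add, AddCircle.coe_sub] at h0
      rw [← sub_eq_zero, ← neg_eq_zero, ← h0]
      abel)
  choose c' hc' using fun g => QuotientAddGroup.mk_surjective (c g)
  choose m hm using fun g h => AddCircle.exists_intCast_eq (x := b g h - (c' h - c' (g * h) + c' g))
    (by
      have := hc g h
      rw [← hc' g, ← hc' h, ← hc' (g * h), ← sub_eq_zero] at this
      exact_mod_cast this)
  refine ⟨m, fun g h j => ?_⟩
  have : (f g h j : ℚ) = m h j - m (g * h) j + m g (h * j) - m g h := by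
    rw [hb, hm, hm, hm, hm, mul_assoc]
    ring
  exact_mod_cast this

/-- Twice an integral `2`-cocycle of `Q₈` is a coboundary. -/
theorem Q8.exists_two_smul_eq_coboundary_of_cocycle (f : Q8 → Q8 → ℤ)
    (hf : ∀ g h j, f h j - f (g * h) j + f g (h * j) - f g h = 0) :
    ∃ c : Q8 → ℤ, ∀ g h, 2 * f g h = c h - c (g * h) + c g := by
  let b (g : Q8) : ℚ := (∑ k, (f g k : ℚ)) / 8
  have hb (g h) : (f g h : ℚ) = b h - b (g * h) + b g := by
    have hsum : ∑ k, ((f h k : ℚ) - f (g * h) k + f g (h * k) - f g h) = 0 :=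
      Finset.sum_eq_zero fun k _ => mod_cast hf g h k
    simp only [Finset.sum_add_distrib, Finset.sum_sub_distrib, Finset.sum_const,
      Finset.card_univ, nsmul_eq_mul, QuaternionGroup.card] at hsum
    rw [(Group.mulLeft_bijective h).sum_comp fun k => (f g k : ℚ)] at hsum
    simp only [b]
    push_cast at hsum
    linear_combination -hsum / 8
  let χ : Q8 →* Multiplicative (AddCircle (1 : ℚ)) :=
    MonoidHom.mk' (fun g => .ofAdd (b g : AddCircle (1 : ℚ))) fun g h => by
      have h0 : ((f g h : ℚ) : AddCircle (1 : ℚ)) = 0 :=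
        (AddCircle.coe_eq_zero_iff _).2 ⟨f g h, by simp⟩
      rw [hb] at h0
      simp only [AddCircle.coe_add, AddCircle.coe_sub] at h0
      rw [← ofAdd_add]
      congr 1
      rw [← sub_eq_zero, ← neg_eq_zero, ← h0]
      abel
  have hχ (g) : χ g ^ 2 = 1 := by
    have ha : χ (.a 1) ^ 2 = 1 := by
      have h : χ (.xa 0 * .a 1) = χ (.a (-1) * .xa 0) := congrArg χ (by decide)
      rw [map_mul, map_mul, mul_comm, mul_left_inj] at h
      rw [sq]
      nth_rw 2 [h]
      rw [← map_mul, QuaternionGroup.a_mul_a, add_neg_cancel, QuaternionGroup.a_zero, map_one]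
    have hx : χ (.xa 0) ^ 2 = 1 := by
      rw [← map_pow, QuaternionGroup.xa_sq, ← QuaternionGroup.a_one_pow, map_pow, ha]
    have : (powMonoidHom 2).comp χ = 1 :=
      QuaternionGroup.monoidHom_ext (by simpa using ha) (by simpa using hx)
    exact DFunLike.congr_fun this g
  choose c hc using fun g => AddCircle.exists_intCast_eq (x := 2 * b g) (by
    have : 2 • (b g : AddCircle (1 : ℚ)) = 0 := hχ g
    rw [← this, two_mul, two_nsmul, AddCircle.coe_add])
  refine ⟨c, fun g h => ?_⟩
  have : (2 * f g h : ℚ) = c h - c (g * h) + c g := by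
    rw [hc, hc, hc, hb]; ring
  exact_mod_cast this

namespace groupCohomology

theorem two_smul_H2_Q8 (z : H2 (Rep.trivial ℤ Q8 ℤ)) : (2 : ℤ) • z = 0 := by
  induction z using H2_induction_on with
  | h x =>
    obtain ⟨c, hc⟩ := Q8.exists_two_smul_eq_coboundary_of_cocycle (fun g h => x (g, h))
      ((mem_cocycles₂_def _).1 x.2)
    rw [two_zsmul, ← map_add, H2π_eq_zero_iff]
    exact ⟨c, funext fun g => (hc g.1 g.2).symm.trans (two_mul _)⟩

/-- A finite group has no nonzero homomorphism to `ℤ`. -/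
theorem subsingleton_H1_int {G : Type} [Group G] [Finite G] :
    Subsingleton (H1 (Rep.trivial ℤ G ℤ)) := by
  refine (H1IsoOfIsTrivial (Rep.trivial ℤ G ℤ)).toLinearEquiv.toEquiv.subsingleton_congr.2 ?_
  refine subsingleton_of_forall_eq 0 fun (f : Additive G →+ ℤ) => AddMonoidHom.ext fun g => ?_
  have h : Nat.card G • f g = 0 := by
    rw [← map_nsmul, Nat.card_congr Additive.ofMul, card_nsmul_eq_zero', map_zero]
  exact (smul_eq_zero.1 h).resolve_left Nat.card_pos.ne'

theorem subsingleton_H3_quaternionGroup {n : ℕ} [NeZero n] :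
    Subsingleton (groupCohomology (Rep.trivial ℤ (QuaternionGroup n) ℤ) 3) := by
  rw [← ModuleCat.isZero_iff_subsingleton, groupCohomology,
    ← HomologicalComplex.exactAt_iff_isZero_homology,
    HomologicalComplex.exactAt_iff' _ 2 3 4 (by simp) (by simp),
    CategoryTheory.ShortComplex.moduleCat_exact_iff]
  intro (x : (Fin 3 → QuaternionGroup n) → ℤ) hx
  replace hx : inhomogeneousCochains.d (Rep.trivial ℤ (QuaternionGroup n) ℤ) 3 x = 0 := by
    rw [← inhomogeneousCochains.d_def]
    exact hx
  obtain ⟨c, hc⟩ := QuaternionGroup.exists_eq_coboundary_of_cocycle₃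
    (fun g h j => x ![g, h, j]) fun g h j k => by
      have h0 : Fin.contractNth 0 (· * ·) ![g, h, j, k] = ![g * h, j, k] := by
        ext i; fin_cases i <;> rfl
      have h1 : Fin.contractNth 1 (· * ·) ![g, h, j, k] = ![g, h * j, k] := by
        ext i; fin_cases i <;> rfl
      have h2 : Fin.contractNth 2 (· * ·) ![g, h, j, k] = ![g, h, j * k] := by
        ext i; fin_cases i <;> rfl
      have h3 : Fin.contractNth 3 (· * ·) ![g, h, j, k] = ![g, h, j] := by
        ext i; fin_cases i <;> rfl
      have := congrFun hx ![g, h, j, k]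
      simp [inhomogeneousCochains.d_hom_apply, Fin.sum_univ_succ, h0, h1, h2, h3] at this
      change _ = (0 : ℤ) at this
      linear_combination this
  have key : inhomogeneousCochains.d (Rep.trivial ℤ (QuaternionGroup n) ℤ) 2
      (fun g => c (g 0) (g 1)) = x := by
    funext g
    have hg : g = ![g 0, g 1, g 2] := by ext i; fin_cases i <;> rfl
    have h0 : Fin.contractNth 0 (· * ·) g = ![g 0 * g 1, g 2] := by
      ext i; fin_cases i <;> rfl
    have h1 : Fin.contractNth 1 (· * ·) g = ![g 0, g 1 * g 2] := by
      ext i; fin_cases i <;> rfl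
    have h2 : Fin.contractNth 2 (· * ·) g = ![g 0, g 1] := by
      ext i; fin_cases i <;> rfl
    have hxg : x g = _ := (congrArg x hg).trans (hc _ _ _)
    rw [hxg]
    simp [inhomogeneousCochains.d_hom_apply, Fin.sum_univ_succ, h0, h1, h2]
    ring
  rw [← inhomogeneousCochains.d_def] at key
  exact ⟨_, key⟩

end groupCohomology

/-- **Statement 13.** For the trivial representation of `Q₈` on `ℤ`: multiplication by `2` is
the zero endomorphism of the abelian group `H²(Q₈; ℤ)`, and `H¹(Q₈; ℤ) = 0`,
`H³(Q₈; ℤ) = 0`.  (These are the facts used to show that the mod-2 Bockstein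
`β₂ : H¹(BQ₈; ℤ/2) → H²(BQ₈; ℤ/2)` is an isomorphism.) -/
theorem q8_integral_cohomology_low_degrees :
    (∀ z : groupCohomology (Rep.trivial ℤ Q8 ℤ) 2, (2 : ℤ) • z = 0) ∧
    Subsingleton (groupCohomology (Rep.trivial ℤ Q8 ℤ) 1) ∧
    Subsingleton (groupCohomology (Rep.trivial ℤ Q8 ℤ) 3) :=
  ⟨groupCohomology.two_smul_H2_Q8, groupCohomology.subsingleton_H1_int,
    groupCohomology.subsingleton_H3_quaternionGroup⟩
end
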